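/- arXiv:2501.13590 — 4 statements merged into one kernel-verified Lean document; each statement's English description precedes it below -/
import Mathlib

section
/- The map ξ is surjective onto S² × S²: for every pair of pure unit quaternions u, v, there exist quaternions x, y with ‖x‖ = ‖y‖ = 1 and Re(x·ȳ) = 0 such that y·x̄ = u and x̄·y = v. -/
open Quaternion

theorem Quaternion.mul_self_eq_neg_one_of_star_eq_neg {u : ℍ[ℝ]} (hu : star u = -u)
    (hu1 : ‖u‖ = 1) : u * u = -1 := by
  have h := Quaternion.self_mul_star u
  rw [hu, Quaternion.normSq_eq_norm_mul_self, hu1] at h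
  rw [← neg_eq_iff_eq_neg, ← mul_neg, h]
  simp

theorem Quaternion.re_eq_zero_of_star_eq_neg {u : ℍ[ℝ]} (hu : star u = -u) : u.re = 0 := by
  have h := congrArg (fun q : ℍ[ℝ] => q.re) hu
  simp only [Quaternion.re_star, Quaternion.re_neg] at h
  linarith

/-- Any two pure unit quaternions are intertwined by a nonzero quaternion. -/
theorem Quaternion.exists_ne_zero_mul_eq_mul {u v : ℍ[ℝ]}
    (hu : star u = -u) (hv : star v = -v) (hu1 : ‖u‖ = 1) (hv1 : ‖v‖ = 1) :
    ∃ w : ℍ[ℝ], w ≠ 0 ∧ u * w = w * v := by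
  have huu := mul_self_eq_neg_one_of_star_eq_neg hu hu1
  have hvv := mul_self_eq_neg_one_of_star_eq_neg hv hv1
  obtain ⟨q, hq⟩ : ∃ q : ℍ[ℝ], u * q + q * v ≠ 0 := by
    by_contra! h
    have hvu : v = -u := by
      have := h 1
      rw [mul_one, one_mul] at this
      exact eq_neg_of_add_eq_zero_right this
    subst hvu
    have h0 := re_eq_zero_of_star_eq_neg hu
    have hu0 : u = 0 := by
      simp only [Quaternion.ext_iff, Quaternion.re_add, Quaternion.imI_add, Quaternion.imJ_add,
        Quaternion.imK_add, Quaternion.re_mul, Quaternion.imI_mul, Quaternion.imJ_mul,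
        Quaternion.imK_mul, Quaternion.re_neg, Quaternion.imI_neg, Quaternion.imJ_neg,
        Quaternion.imK_neg, Quaternion.re_zero, Quaternion.imI_zero, Quaternion.imJ_zero,
        Quaternion.imK_zero] at h ⊢
      obtain ⟨-, -, hi₁, hi₂⟩ := h ⟨0, 1, 0, 0⟩
      obtain ⟨-, -, -, hj⟩ := h ⟨0, 0, 1, 0⟩
      dsimp only at hi₁ hi₂ hj
      refine ⟨h0, ?_, ?_, ?_⟩ <;> linarith
    simp [hu0] at hu1
  refine ⟨u * q + q * v, hq, ?_⟩
  rw [mul_add, add_mul, ← mul_assoc, huu, mul_assoc q, hvv, mul_assoc u]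
  simp [add_comm]

/-- Surjectivity of `ξ(x, y) = (y·x̄, x̄·y)` from the Stiefel manifold `V₂(ℝ⁴)` onto
`S² × S²`: for all pure unit quaternions `u, v` there exist `x, y` with
`‖x‖ = ‖y‖ = 1`, `Re(x·ȳ) = 0`, `y·x̄ = u` and `x̄·y = v`. -/
theorem xi_surjective (u v : ℍ[ℝ])
    (hu : star u = -u) (hv : star v = -v) (hu1 : ‖u‖ = 1) (hv1 : ‖v‖ = 1) :
    ∃ x y : ℍ[ℝ], ‖x‖ = 1 ∧ ‖y‖ = 1 ∧ (x * star y).re = 0 ∧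
      y * star x = u ∧ star x * y = v := by
  obtain ⟨w, hw, huw⟩ := Quaternion.exists_ne_zero_mul_eq_mul hu hv hu1 hv1
  obtain ⟨x, hx, hux⟩ : ∃ x : ℍ[ℝ], ‖x‖ = 1 ∧ u * x = x * v :=
    ⟨‖w‖⁻¹ • w, by simp [norm_smul, hw], by rw [mul_smul_comm, smul_mul_assoc, huw]⟩
  have hxs : x * star x = 1 := by
    rw [Quaternion.self_mul_star, Quaternion.normSq_eq_norm_mul_self, hx]; simp
  have hsx : star x * x = 1 := by
    rw [Quaternion.star_mul_self, Quaternion.normSq_eq_norm_mul_self, hx]; simp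
  refine ⟨x, u * x, hx, by rw [norm_mul, hu1, hx, one_mul], ?_, ?_, ?_⟩
  · rw [star_mul, ← mul_assoc, hxs, one_mul, Quaternion.re_star]
    exact Quaternion.re_eq_zero_of_star_eq_neg hu
  · rw [mul_assoc, hxs, mul_one]
  · rw [hux, ← mul_assoc, hsx, one_mul]
end

section
/- Suppose (x, y) and (q, z) are pairs of quaternions with ‖x‖ = ‖y‖ = ‖q‖ = ‖z‖ = 1, Re(x·ȳ) = 0, Re(q·z̄) = 0, and suppose y·x̄ = z·q̄ and x̄·y = q̄·z. Then there exist real numbers α, β with α² + β² = 1 such that q = α·x + β·y and z = −β·x + α·y; that is, (q, z) and (x, y) differ by a rotation in SO(2). -/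
open Quaternion

/-- A quaternion commuting with an imaginary unit `v` lies in the real span of `1` and `v`. -/
theorem Quaternion.eq_re_add_smul_of_commute {p v : ℍ[ℝ]} (hre : v.re = 0)
    (hv : v.imI ^ 2 + v.imJ ^ 2 + v.imK ^ 2 = 1) (h : v * p = p * v) :
    p = (p.re : ℍ[ℝ]) + (-(p * v).re) • v := by
  have hI := congrArg QuaternionAlgebra.imI h
  have hJ := congrArg QuaternionAlgebra.imJ h
  have hK := congrArg QuaternionAlgebra.imK h
  simp only [Quaternion.imI_mul, Quaternion.imJ_mul, Quaternion.imK_mul, hre] at hI hJ hK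
  ext
  · simp [hre]
  · simp [hre]
    linear_combination (-p.imI) * hv + v.imK / 2 * hJ - v.imJ / 2 * hK
  · simp [hre]
    linear_combination (-p.imJ) * hv + v.imI / 2 * hK - v.imK / 2 * hI
  · simp [hre]
    linear_combination (-p.imK) * hv + v.imJ / 2 * hI - v.imI / 2 * hJ

/-- If `(x, y)` and `(q, z)` are orthonormal pairs of quaternions with
`y·x̄ = z·q̄` and `x̄·y = q̄·z`, then `(q, z)` and `(x, y)` differ by a rotation in
`SO(2)`: there are reals `α, β` with `α² + β² = 1`, `q = αx + βy`, `z = −βx + αy`. -/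
theorem xi_fibres (x y q z : ℍ[ℝ])
    (hx : ‖x‖ = 1) (hy : ‖y‖ = 1) (hq : ‖q‖ = 1) (hz : ‖z‖ = 1)
    (hxy : (x * star y).re = 0) (hqz : (q * star z).re = 0)
    (h1 : y * star x = z * star q) (h2 : star x * y = star q * z) :
    ∃ α β : ℝ, α ^ 2 + β ^ 2 = 1 ∧ q = α • x + β • y ∧ z = -β • x + α • y := by
  have unit_mul {a : ℍ[ℝ]} (ha : ‖a‖ = 1) : a * star a = 1 ∧ star a * a = 1 := by
    have hn : normSq a = 1 := by rw [normSq_eq_norm_mul_self, ha, one_mul]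
    simp [Quaternion.self_mul_star, Quaternion.star_mul_self, hn]
  obtain ⟨hx1, hx2⟩ := unit_mul hx
  obtain ⟨hq1, hq2⟩ := unit_mul hq
  obtain ⟨v, hv⟩ : ∃ v, v = star x * y := ⟨_, rfl⟩
  obtain ⟨p, hp⟩ : ∃ p, p = star x * q := ⟨_, rfl⟩
  have hyv : y = x * v := by rw [hv, ← mul_assoc, hx1, one_mul]
  have hzv : z = q * v := by rw [hv, h2, ← mul_assoc, hq1, one_mul]
  have hqp : q = x * p := by rw [hp, ← mul_assoc, hx1, one_mul]
  have hre : v.re = 0 := by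
    rw [hv]
    simp at hxy ⊢
    linear_combination hxy
  have hvn : v.imI ^ 2 + v.imJ ^ 2 + v.imK ^ 2 = 1 := by
    have h : normSq v = 1 := by
      rw [normSq_eq_norm_mul_self, hv, norm_mul, norm_star, hx, hy]; norm_num
    rw [normSq_def', hre] at h
    linear_combination h
  have hcomm : v * p = p * v := by
    calc v * p = star x * (y * star x) * q := by rw [hv, hp]; simp only [mul_assoc]
      _ = star x * z * (star q * q) := by rw [h1]; simp only [mul_assoc]
      _ = p * v := by rw [hq2, mul_one, hzv, hp, mul_assoc]
  have hpn : normSq p = 1 := by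
    rw [normSq_eq_norm_mul_self, hp, norm_mul, norm_star, hx, hq]; norm_num
  have hspan := Quaternion.eq_re_add_smul_of_commute hre hvn hcomm
  generalize p.re = α at hspan
  generalize -(p * v).re = β at hspan
  have hvv : v * v = -1 := by
    ext <;> simp [hre]
    · linear_combination -hvn
    · ring
    · ring
    · ring
  have hq' : q = α • x + β • y := by
    rw [hqp, hspan, hyv, mul_add, mul_smul_comm, ← Quaternion.coe_commutes,
      Quaternion.coe_mul_eq_smul]
  refine ⟨α, β, ?_, hq', ?_⟩
  · rw [hspan, normSq_def'] at hpn
    simp [hre] at hpn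
    linear_combination hpn - β ^ 2 * hvn
  · rw [hzv, hq', add_mul, smul_mul_assoc, smul_mul_assoc, ← hyv, hyv, mul_assoc x v v, hvv]
    simp [add_comm]
end

section
/- Sp(1)Sp(1)-equivariance of μ_H: for all quaternions x, y ∈ ℍ and all unit quaternions g, h (‖g‖ = ‖h‖ = 1), μ_H(g·x·h̄, g·y·h̄) = g·μ_H(x, y)·ḡ. -/
open Quaternion

/-- The map `μ_H : ℍ × ℍ → ℍ`, `μ_H(x, y) = (1/2)(y·x̄ − x·ȳ)`. -/
noncomputable def muH (x y : ℍ[ℝ]) : ℍ[ℝ] := (1/2 : ℝ) • (y * star x - x * star y)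

/-- Right multiplication by a unit quaternion preserves the pairing `(a, b) ↦ a·b̄`. -/
theorem mul_star_mul_star_of_norm_eq_one (a b : ℍ[ℝ]) {h : ℍ[ℝ]} (hh : ‖h‖ = 1) :
    a * star h * star (b * star h) = a * star b := by
  have key : star h * h = 1 := by
    rw [Quaternion.star_mul_self, Quaternion.normSq_eq_norm_mul_self, hh, mul_one,
      Quaternion.coe_one]
  rw [star_mul, star_star, mul_assoc, ← mul_assoc (star h), key, one_mul]

/-- `Sp(1)Sp(1)`-equivariance of `μ_H`: for unit quaternions `g, h`,
`μ_H(g·x·h̄, g·y·h̄) = g·μ_H(x, y)·ḡ`. -/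
theorem muH_equivariant (x y g h : ℍ[ℝ]) (hg : ‖g‖ = 1) (hh : ‖h‖ = 1) :
    muH (g * x * star h) (g * y * star h) = g * muH x y * star g := by
  rw [muH, mul_star_mul_star_of_norm_eq_one _ _ hh, mul_star_mul_star_of_norm_eq_one _ _ hh]
  simp only [muH, star_mul, mul_smul_comm,
    smul_mul_assoc, mul_sub, sub_mul, mul_assoc]
end

section
/- Let x₁, x₂, y₁, y₂ ∈ ℍ be quaternions such that μ_H(x₁, y₁) = 0, μ_H(x₂, y₂) = 0, and x₁·y₂ = y₁·x₂. Then the pairs (x₁, x₂) and (y₁, y₂) are linearly dependent in ℍ × ℍ over ℝ, i.e. there exist reals a, b, not both zero, with a·(x₁, x₂) + b·(y₁, y₂) = (0, 0). -/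
open Quaternion

theorem exists_eq_smul_of_muH_eq_zero {x y : ℍ[ℝ]} (hx : x ≠ 0) (h : muH x y = 0) :
    ∃ r : ℝ, y = r • x := by
  have hsub : y * star x - x * star y = 0 :=
    (smul_eq_zero.mp h).resolve_left (by norm_num)
  have hstar : star (y * star x) = y * star x := by
    rw [star_mul, star_star, sub_eq_zero.mp hsub]
  obtain ⟨c, hc⟩ : ∃ c : ℝ, y * star x = c := ⟨_, Quaternion.star_eq_self.mp hstar⟩
  have hn : Quaternion.normSq x ≠ 0 := Quaternion.normSq_ne_zero.mpr hx
  refine ⟨(Quaternion.normSq x)⁻¹ * c, ?_⟩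
  have key : Quaternion.normSq x • y = c • x := by
    rw [← Quaternion.coe_mul_eq_smul c, ← hc, mul_assoc, Quaternion.star_mul_self,
      Quaternion.mul_coe_eq_smul]
  rw [mul_smul, ← key, inv_smul_smul₀ hn]

/-- If `μ_H(x₁, y₁) = 0`, `μ_H(x₂, y₂) = 0` and `x₁·y₂ = y₁·x₂`, then the pairs
`(x₁, x₂)` and `(y₁, y₂)` are linearly dependent in `ℍ × ℍ` over `ℝ`. -/
theorem pairs_linearDependent (x₁ x₂ y₁ y₂ : ℍ[ℝ])
    (h1 : muH x₁ y₁ = 0) (h2 : muH x₂ y₂ = 0) (h3 : x₁ * y₂ = y₁ * x₂) :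
    ∃ a b : ℝ, (a ≠ 0 ∨ b ≠ 0) ∧
      a • (x₁, x₂) + b • (y₁, y₂) = ((0 : ℍ[ℝ]), (0 : ℍ[ℝ])) := by
  suffices h : (x₁ = 0 ∧ x₂ = 0) ∨ ∃ r : ℝ, y₁ = r • x₁ ∧ y₂ = r • x₂ by
    rcases h with ⟨rfl, rfl⟩ | ⟨r, rfl, rfl⟩
    · exact ⟨1, 0, by simp, by simp⟩
    · exact ⟨r, -1, by simp, by simp⟩
  by_cases hx₁ : x₁ = 0
  · by_cases hx₂ : x₂ = 0
    · exact Or.inl ⟨hx₁, hx₂⟩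
    · obtain ⟨r, hr⟩ := exists_eq_smul_of_muH_eq_zero hx₂ h2
      have hy₁ : y₁ = 0 := by
        rw [hx₁, zero_mul] at h3
        exact (mul_eq_zero.mp h3.symm).resolve_right hx₂
      exact Or.inr ⟨r, by rw [hx₁, hy₁, smul_zero], hr⟩
  · obtain ⟨r, hr⟩ := exists_eq_smul_of_muH_eq_zero hx₁ h1
    refine Or.inr ⟨r, hr, mul_left_cancel₀ hx₁ ?_⟩
    rw [h3, hr, smul_mul_assoc, mul_smul_comm]
end
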